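/- For a module M of finite quasi-Gorenstein projective dimension, the quasi-Gorenstein projective dimension equals the supremum of all m such that Ext^m(M, Q) ≠ 0 for some quasi-projective module Q. -/

import Mathlib

open CategoryTheory

universe u
variable {R : Type u} [Ring R]

/-- A module `Q` is quasi-projective if every homomorphism from `Q` to a quotient
of `Q` lifts to an endomorphism of `Q`. -/
def QuasiProjective (Q : ModuleCat.{u} R) : Prop :=
  ∀ (B : ModuleCat.{u} R) (g : Q ⟶ B), Function.Surjective g →
    ∀ f : Q ⟶ B, ∃ h : Q ⟶ Q, h ≫ g = f

/-- `M` is quasi-Gorenstein projective if it is a syzygy of an exact complex of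
projective modules (given by short exact sequences `0 → K (n+1) → P n → K n → 0`)
that remains exact under `Hom(-, Q)` for every quasi-projective module `Q`. -/
def QuasiGorensteinProjective (M : ModuleCat.{u} R) : Prop :=
  ∃ (K P : ℤ → ModuleCat.{u} R) (ι : ∀ n, K (n + 1) ⟶ P n) (π : ∀ n, P n ⟶ K n),
    (∀ n, Module.Projective R (P n)) ∧
    (∀ n, Function.Injective (ι n)) ∧
    (∀ n, Function.Surjective (π n)) ∧
    (∀ n, Function.Exact (ι n) (π n)) ∧
    (∀ n (Q : ModuleCat.{u} R), QuasiProjective Q →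
      ∀ f : K (n + 1) ⟶ Q, ∃ g : P n ⟶ Q, ι n ≫ g = f) ∧
    Nonempty (M ≅ K 0)

/-- `qgpdimLE n M` means the quasi-Gorenstein projective dimension of `M`
is at most `n`: there is a resolution of `M` of length `n` by
quasi-Gorenstein projective modules. -/
def qgpdimLE : ℕ → ModuleCat.{u} R → Prop
  | 0, M => QuasiGorensteinProjective M
  | n + 1, M => ∃ (K G : ModuleCat.{u} R) (f : K ⟶ G) (g : G ⟶ M),
      QuasiGorensteinProjective G ∧ Function.Injective f ∧ Function.Surjective g ∧
      Function.Exact f g ∧ qgpdimLE n K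

/-- The quasi-Gorenstein projective dimension of `M`, as an element of `ℕ∞`
(`⊤` if no finite resolution exists). -/
noncomputable def qgpdim (M : ModuleCat.{u} R) : ℕ∞ :=
  sInf ((fun m : ℕ => (m : ℕ∞)) '' {m : ℕ | qgpdimLE m M})

theorem ext_bridge (M Q : ModuleCat.{u} R) (n : ℕ) :
    Subsingleton (((Ext ℤ (ModuleCat.{u} R) (n+1)).obj (Opposite.op M)).obj Q) ↔
    Subsingleton (Abelian.Ext.{u} M Q (n+1)) := by
  let P := projectiveResolution M
  rw [← ModuleCat.isZero_iff_subsingleton, (P.isoExt (n+1) Q).isZero_iff,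
    ← HomologicalComplex.exactAt_iff_isZero_homology, HomologicalComplex.exactAt_iff' _ n (n+1) (n+2) (by simp) (by simp),
    ShortComplex.moduleCat_exact_iff]
  constructor
  · intro h
    refine subsingleton_of_forall_eq 0 fun x => ?_
    obtain ⟨f, hf, rfl⟩ := P.extMk_surjective x (n+2) rfl
    rw [P.extMk_eq_zero_iff _ _ _ _ n rfl]
    exact h f hf
  · intro h (f : P.complex.X (n+1) ⟶ Q) (hf : P.complex.d (n+2) (n+1) ≫ f = 0)
    have := (P.extMk_eq_zero_iff f (n+2) rfl hf n rfl).1 (Subsingleton.elim _ _)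
    exact this

/-- There is a short exact sequence `0 → A → B → C → 0`. -/
def SES (A B C : ModuleCat.{u} R) : Prop :=
  ∃ (f : A ⟶ B) (g : B ⟶ C) (w : f ≫ g = 0), (ShortComplex.mk f g w).ShortExact

theorem SES.of_fun {A B C : ModuleCat.{u} R} (f : A ⟶ B) (g : B ⟶ C)
    (hf : Function.Injective f) (hg : Function.Surjective g) (h : Function.Exact f g) :
    ∃ w : f ≫ g = 0, (ShortComplex.mk f g w).ShortExact := by
  have w : f ≫ g = 0 := by
    ext x
    exact h.apply_apply_eq_zero x
  exact ⟨w, ModuleCat.shortComplex_shortExact _ h hf hg⟩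

theorem SES.mid {A B C Q : ModuleCat.{u} R} (h : SES A B C) (n : ℕ)
    (hA : Subsingleton (Abelian.Ext.{u} A Q n)) (hC : Subsingleton (Abelian.Ext.{u} C Q n)) :
    Subsingleton (Abelian.Ext.{u} B Q n) := by
  obtain ⟨f, g, w, hS⟩ := h
  refine subsingleton_of_forall_eq 0 fun x => ?_
  obtain ⟨y, rfl⟩ := Abelian.Ext.contravariant_sequence_exact₂ hS Q x
    (Subsingleton.elim (h := hA) _ _)
  rw [Subsingleton.elim (h := hC) y 0]
  simp

theorem SES.right {A B C Q : ModuleCat.{u} R} (h : SES A B C) (n : ℕ)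
    (hA : Subsingleton (Abelian.Ext.{u} A Q n)) (hB : Subsingleton (Abelian.Ext.{u} B Q (n + 1))) :
    Subsingleton (Abelian.Ext.{u} C Q (n + 1)) := by
  obtain ⟨f, g, w, hS⟩ := h
  refine subsingleton_of_forall_eq 0 fun x => ?_
  obtain ⟨y, rfl⟩ := Abelian.Ext.contravariant_sequence_exact₃ hS Q x
    (Subsingleton.elim (h := hB) _ _) (add_comm 1 n)
  rw [Subsingleton.elim (h := hA) y 0]
  simp

theorem SES.left {A B C Q : ModuleCat.{u} R} (h : SES A B C) (n : ℕ)
    (hB : Subsingleton (Abelian.Ext.{u} B Q n)) (hC : Subsingleton (Abelian.Ext.{u} C Q (n + 1))) :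
    Subsingleton (Abelian.Ext.{u} A Q n) := by
  obtain ⟨f, g, w, hS⟩ := h
  refine subsingleton_of_forall_eq 0 fun x => ?_
  obtain ⟨y, rfl⟩ := Abelian.Ext.contravariant_sequence_exact₁ hS Q x (add_comm 1 n)
    (Subsingleton.elim (h := hC) _ _)
  rw [Subsingleton.elim (h := hB) y 0]
  simp

theorem extend_of_ext {S : ShortComplex (ModuleCat.{u} R)} (hS : S.ShortExact)
    {Q : ModuleCat.{u} R} (h : Subsingleton (Abelian.Ext.{u} S.X₃ Q 1)) (f : S.X₁ ⟶ Q) :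
    ∃ g : S.X₂ ⟶ Q, S.f ≫ g = f := by
  obtain ⟨y, hy⟩ := Abelian.Ext.contravariant_sequence_exact₁ hS Q (Abelian.Ext.mk₀ f)
    (add_zero 1) (Subsingleton.elim (h := h) _ _)
  obtain ⟨g, rfl⟩ := (Abelian.Ext.mk₀_bijective _ _).2 y
  refine ⟨g, (Abelian.Ext.mk₀_bijective _ _).1 ?_⟩
  simpa using hy

theorem ext_of_extend {S : ShortComplex (ModuleCat.{u} R)} (hS : S.ShortExact) [Projective S.X₂]
    {Q : ModuleCat.{u} R} (h : ∀ f : S.X₁ ⟶ Q, ∃ g : S.X₂ ⟶ Q, S.f ≫ g = f) :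
    Subsingleton (Abelian.Ext.{u} S.X₃ Q 1) := by
  refine subsingleton_of_forall_eq 0 fun x => ?_
  obtain ⟨y, rfl⟩ := Abelian.Ext.contravariant_sequence_exact₃ hS Q x
    (Abelian.Ext.eq_zero_of_projective _) (add_zero 1)
  obtain ⟨f, rfl⟩ := (Abelian.Ext.mk₀_bijective _ _).2 y
  obtain ⟨g, rfl⟩ := h f
  rw [← Abelian.Ext.mk₀_comp_mk₀]
  exact hS.extClass_comp_assoc _

theorem SES.swap {A B C : ModuleCat.{u} R} (h : SES A B C)
    (hC : Subsingleton (Abelian.Ext.{u} C A 1)) : SES C B A := by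
  obtain ⟨f, g, w, hS⟩ := h
  obtain ⟨r, hr⟩ := extend_of_ext hS hC (𝟙 A)
  let s := ShortComplex.Splitting.ofExactOfRetraction _ hS.exact r hr hS.epi_g
  let t : (ShortComplex.mk s.s s.r s.s_r).Splitting :=
    { r := g, s := f, f_r := s.s_g, s_g := s.f_r, id := by rw [add_comm]; exact s.id }
  exact ⟨s.s, s.r, s.s_r, t.shortExact⟩

theorem SES.projective {A B C : ModuleCat.{u} R} (h : SES A B C) (hA : Projective A)
    (hC : Projective C) : Projective B := by
  obtain ⟨f, g, w, hS⟩ := h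
  have hC' : Subsingleton (Abelian.Ext.{u} C A 1) := Abelian.Ext.subsingleton_of_projective C A 0
  obtain ⟨r, hr⟩ := extend_of_ext hS hC' (𝟙 A)
  let s := ShortComplex.Splitting.ofExactOfRetraction _ hS.exact r hr hS.epi_g
  exact Projective.of_iso s.isoBinaryBiproduct.symm inferInstance

open Limits in
theorem SES.pushout {A B C D E : ModuleCat.{u} R} (h : SES A B C) (h' : SES A D E) :
    ∃ X, SES D X C ∧ SES B X E := by
  obtain ⟨f, g, w, hS⟩ := h
  obtain ⟨j, q, w', hS'⟩ := h'
  have : Mono f := hS.mono_f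
  have : Mono j := hS'.mono_f
  have : Epi g := hS.epi_g
  have : Epi q := hS'.epi_g
  refine ⟨Limits.pushout f j, ⟨pushout.inr f j, pushout.desc g 0 (by simp [w]), pushout.inr_desc _ _ _, ?_⟩,
    ⟨pushout.inl f j, pushout.desc 0 q (by simp [w']), pushout.inl_desc _ _ _, ?_⟩⟩
  · have : Epi (pushout.desc g (0 : D ⟶ C) (by simp [w]) : Limits.pushout f j ⟶ C) :=
      epi_of_epi_fac (pushout.inl_desc _ _ _)
    refine { exact := ShortComplex.exact_of_g_is_cokernel _
              (CokernelCofork.IsColimit.ofπ' _ _ fun {T} k hk => ?_)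
             mono_f := by dsimp; infer_instance, epi_g := by dsimp; infer_instance }
    dsimp at k hk
    have e : f ≫ pushout.inl f j ≫ k = 0 := by
      rw [pushout.condition_assoc, hk, comp_zero]
    refine ⟨hS.gIsCokernel.desc (CokernelCofork.ofπ (pushout.inl f j ≫ k) e), ?_⟩
    apply pushout.hom_ext
    · rw [pushout.inl_desc_assoc]
      exact hS.gIsCokernel.fac (CokernelCofork.ofπ (pushout.inl f j ≫ k) e) WalkingParallelPair.one
    · rw [pushout.inr_desc_assoc, hk, zero_comp]
  · have : Epi (pushout.desc (0 : B ⟶ E) q (by simp [w']) : Limits.pushout f j ⟶ E) :=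
      epi_of_epi_fac (pushout.inr_desc _ _ _)
    refine { exact := ShortComplex.exact_of_g_is_cokernel _
              (CokernelCofork.IsColimit.ofπ' _ _ fun {T} k hk => ?_)
             mono_f := by dsimp; infer_instance, epi_g := by dsimp; infer_instance }
    dsimp at k hk
    have e : j ≫ pushout.inr f j ≫ k = 0 := by
      rw [← pushout.condition_assoc, hk, comp_zero]
    refine ⟨hS'.gIsCokernel.desc (CokernelCofork.ofπ (pushout.inr f j ≫ k) e), ?_⟩
    apply pushout.hom_ext
    · rw [pushout.inl_desc_assoc, hk, zero_comp]
    · rw [pushout.inr_desc_assoc]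
      exact hS'.gIsCokernel.fac (CokernelCofork.ofπ (pushout.inr f j ≫ k) e) WalkingParallelPair.one

open Limits in
theorem SES.octahedral {A B C D E : ModuleCat.{u} R} (h : SES A B C) (h' : SES B D E) :
    ∃ F, SES A D F ∧ SES C F E := by
  obtain ⟨f, g, w, hS⟩ := h
  obtain ⟨j, q, w', hS'⟩ := h'
  have : Mono f := hS.mono_f
  have : Mono j := hS'.mono_f
  have : Epi g := hS.epi_g
  have : Epi q := hS'.epi_g
  have hAF : (ShortComplex.mk (f ≫ j) (cokernel.π (f ≫ j)) (by simp)).ShortExact :=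
    { exact := ShortComplex.exact_of_g_is_cokernel _ (cokernelIsCokernel _)
      mono_f := by dsimp; infer_instance, epi_g := by dsimp; infer_instance }
  have e : f ≫ j ≫ cokernel.π (f ≫ j) = 0 := by
    rw [← Category.assoc, cokernel.condition]
  obtain ⟨c, hc⟩ : ∃ c : C ⟶ cokernel (f ≫ j), g ≫ c = j ≫ cokernel.π (f ≫ j) :=
    ⟨_, hS.gIsCokernel.fac (CokernelCofork.ofπ (j ≫ cokernel.π (f ≫ j)) e)
      WalkingParallelPair.one⟩
  let d : cokernel (f ≫ j) ⟶ E := cokernel.desc _ q (by simp [w'])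
  have hd : cokernel.π (f ≫ j) ≫ d = q := cokernel.π_desc _ _ _
  have hcd : c ≫ d = 0 := by
    rw [← cancel_epi g, reassoc_of% hc, hd, w', comp_zero]
  have : Epi d := epi_of_epi_fac hd
  have : Mono c := by
    rw [ModuleCat.mono_iff_injective, injective_iff_map_eq_zero]
    intro x hx
    obtain ⟨b, rfl⟩ := (ModuleCat.epi_iff_surjective g).1 inferInstance x
    have h1 : cokernel.π (f ≫ j) (j b) = 0 := by
      have := ConcreteCategory.congr_hom hc b
      simp only [ConcreteCategory.comp_apply] at this
      rw [← this, hx]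
    obtain ⟨a, ha⟩ := (ShortComplex.moduleCat_exact_iff _).1 hAF.exact (j b) h1
    have : f a = b := (ModuleCat.mono_iff_injective j).1 inferInstance ha
    rw [← this]
    exact ConcreteCategory.congr_hom w a
  refine ⟨cokernel (f ≫ j), ⟨_, _, _, hAF⟩, ⟨c, d, hcd, ?_⟩⟩
  refine { exact := ShortComplex.exact_of_g_is_cokernel _
            (CokernelCofork.IsColimit.ofπ' _ _ fun {T} k hk => ?_)
           mono_f := by dsimp; infer_instance, epi_g := by dsimp; infer_instance }
  dsimp at k hk
  have e : j ≫ cokernel.π (f ≫ j) ≫ k = 0 := by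
    rw [← reassoc_of% hc, hk, comp_zero]
  obtain ⟨l, hl⟩ : {l : E ⟶ T // q ≫ l = cokernel.π (f ≫ j) ≫ k} :=
    ⟨_, hS'.gIsCokernel.fac (CokernelCofork.ofπ (cokernel.π (f ≫ j) ≫ k) e)
      WalkingParallelPair.one⟩
  refine ⟨l, ?_⟩
  dsimp
  rw [← cancel_epi (cokernel.π (f ≫ j)), reassoc_of% hd, hl]

/-- Vanishing of positive `Ext` into quasi-projectives. -/
def VanishExt (M : ModuleCat.{u} R) : Prop :=
  ∀ Q : ModuleCat.{u} R, QuasiProjective Q → ∀ n : ℕ, Subsingleton (Abelian.Ext.{u} M Q (n + 1))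

theorem quasiProjective_of_projective (P : ModuleCat.{u} R) (hP : Projective P) :
    QuasiProjective P := by
  intro B g hg f
  have : Epi g := (ModuleCat.epi_iff_surjective g).2 hg
  exact ⟨Projective.factorThru f g, Projective.factorThru_comp f g⟩

theorem vanish_of_projective (P : ModuleCat.{u} R) (hP : Projective P) : VanishExt P :=
  fun Q _ n => Abelian.Ext.subsingleton_of_projective P Q n

/-- One step of a `Hom(-, Q)`-exact complex of projectives. -/
def QStep (A B : ModuleCat.{u} R) : Prop :=
  ∃ (P : ModuleCat.{u} R) (ι : A ⟶ P) (π : P ⟶ B), Module.Projective R P ∧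
    Function.Injective ι ∧ Function.Surjective π ∧ Function.Exact ι π ∧
    ∀ Q : ModuleCat.{u} R, QuasiProjective Q → ∀ f : A ⟶ Q, ∃ g : P ⟶ Q, ι ≫ g = f

theorem qgp_of_steps (K : ℤ → ModuleCat.{u} R) (h : ∀ n, QStep (K (n + 1)) (K n)) :
    QuasiGorensteinProjective (K 0) := by
  choose P ι π h1 h2 h3 h4 h5 using h
  exact ⟨K, P, ι, π, h1, h2, h3, h4, h5, ⟨Iso.refl _⟩⟩

theorem qgp_steps {M : ModuleCat.{u} R} (h : QuasiGorensteinProjective M) :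
    ∃ K : ℤ → ModuleCat.{u} R, (∀ n, QStep (K (n + 1)) (K n)) ∧ Nonempty (M ≅ K 0) := by
  obtain ⟨K, P, ι, π, h1, h2, h3, h4, h5, h6⟩ := h
  exact ⟨K, fun n => ⟨P n, ι n, π n, h1 n, h2 n, h3 n, h4 n, h5 n⟩, h6⟩

theorem QStep.ses {A B : ModuleCat.{u} R} (h : QStep A B) :
    ∃ P, Projective P ∧ SES A P B ∧
      ∀ Q : ModuleCat.{u} R, QuasiProjective Q → Subsingleton (Abelian.Ext.{u} B Q 1) := by
  obtain ⟨P, ι, π, h1, h2, h3, h4, h5⟩ := h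
  obtain ⟨w, hS⟩ := SES.of_fun ι π h2 h3 h4
  have hP : Projective P := (IsProjective.iff_projective P).1 h1
  exact ⟨P, hP, ⟨ι, π, w, hS⟩, fun Q hQ => ext_of_extend hS (h5 Q hQ)⟩

theorem SES.qstep {A P B : ModuleCat.{u} R} (h : SES A P B) (hP : Projective P)
    (hB : VanishExt B) : QStep A B := by
  obtain ⟨f, g, w, hS⟩ := h
  exact ⟨P, f, g, (IsProjective.iff_projective P).2 hP, hS.moduleCat_injective_f,
    hS.moduleCat_surjective_g,
    (ShortComplex.ShortExact.moduleCat_exact_iff_function_exact _).1 hS.exact,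
    fun Q hQ k => extend_of_ext hS (hB Q hQ 0) k⟩

theorem vanish_of_steps (K : ℤ → ModuleCat.{u} R) (h : ∀ n, QStep (K (n + 1)) (K n)) (n : ℤ) :
    VanishExt (K n) := by
  intro Q hQ i
  induction i generalizing n with
  | zero =>
    obtain ⟨P, hP, hs, hv⟩ := (h n).ses
    exact hv Q hQ
  | succ i ih =>
    obtain ⟨P, hP, hs, hv⟩ := (h n).ses
    exact hs.right (i + 1) (ih (n + 1)) (vanish_of_projective P hP Q hQ (i + 1))

theorem SES.iso_left {A A' B C : ModuleCat.{u} R} (e : A' ≅ A) (h : SES A B C) :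
    SES A' B C := by
  obtain ⟨f, g, w, hS⟩ := h
  refine ⟨e.hom ≫ f, g, by simp [w], ?_⟩
  let i : ShortComplex.mk f g w ≅ ShortComplex.mk (e.hom ≫ f) g (by simp [w]) :=
    ShortComplex.isoMk e.symm (Iso.refl _) (Iso.refl _) (by simp) (by simp)
  exact ShortComplex.shortExact_of_iso i hS

theorem qgp_vanish {M : ModuleCat.{u} R} (h : QuasiGorensteinProjective M) : VanishExt M := by
  obtain ⟨K, hK, ⟨e⟩⟩ := qgp_steps h
  intro Q hQ n
  have := vanish_of_steps K hK 0 Q hQ n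
  refine subsingleton_of_forall_eq 0 fun x => ?_
  have h1 : (Abelian.Ext.mk₀ e.hom).comp ((Abelian.Ext.mk₀ e.inv).comp x (zero_add _))
      (zero_add _) = x := by
    rw [Abelian.Ext.mk₀_comp_mk₀_assoc]
    simp
  rw [← h1, Subsingleton.elim ((Abelian.Ext.mk₀ e.inv).comp x (zero_add _)) 0]
  simp

theorem qgp_next {M : ModuleCat.{u} R} (h : QuasiGorensteinProjective M) :
    ∃ P M', Projective P ∧ SES M P M' ∧ QuasiGorensteinProjective M' := by
  obtain ⟨K, hK, ⟨e⟩⟩ := qgp_steps h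
  obtain ⟨P, hP, hs, -⟩ := (hK (-1)).ses
  refine ⟨P, K (-1), hP, hs.iso_left e, ?_⟩
  refine qgp_of_steps (fun n => K (n - 1)) fun n => ?_
  have := hK (n - 1)
  rwa [show n - 1 + 1 = n + 1 - 1 by ring] at this

theorem vanish_syzygy (M : ModuleCat.{u} R) (h : VanishExt M) :
    ∃ M', VanishExt M' ∧ QStep M' M := by
  have hs : SES (Limits.kernel (Projective.π M)) (Projective.over M) M :=
    ⟨Limits.kernel.ι _, Projective.π M, by simp,
      { exact := ShortComplex.exact_of_f_is_kernel _ (Limits.kernelIsKernel _)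
        mono_f := by dsimp; infer_instance, epi_g := by dsimp; infer_instance }⟩
  refine ⟨_, fun Q hQ n => hs.left _ (vanish_of_projective _ inferInstance Q hQ n)
    (h Q hQ (n + 1)), hs.qstep inferInstance h⟩

theorem qgp_coind (S : ModuleCat.{u} R → Prop)
    (hS : ∀ M, S M → VanishExt M ∧ ∃ P M', Projective P ∧ SES M P M' ∧ S M')
    (M : ModuleCat.{u} R) (hM : S M) : QuasiGorensteinProjective M := by
  have hr : ∀ A : {A // S A}, ∃ B : {A // S A}, QStep A.1 B.1 := by
    rintro ⟨A, hA⟩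
    obtain ⟨-, P, M', hP, hs, hM'⟩ := hS A hA
    exact ⟨⟨M', hM'⟩, hs.qstep hP (hS M' hM').1⟩
  have hl : ∀ A : {A : ModuleCat.{u} R // VanishExt A},
      ∃ B : {A : ModuleCat.{u} R // VanishExt A}, QStep B.1 A.1 := by
    rintro ⟨A, hA⟩
    obtain ⟨B, hB, h⟩ := vanish_syzygy A hA
    exact ⟨⟨B, hB⟩, h⟩
  choose r hr using hr
  choose l hl using hl
  let rs : ℕ → {A // S A} := fun n => r^[n] ⟨M, hM⟩
  let ls : ℕ → {A : ModuleCat.{u} R // VanishExt A} := fun n => l^[n] ⟨M, (hS M hM).1⟩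
  have hrs : ∀ n, QStep (rs n).1 (rs (n + 1)).1 := fun n => by
    have := hr (rs n)
    rwa [← Function.iterate_succ_apply' r n] at this
  have hls : ∀ n, QStep (ls (n + 1)).1 (ls n).1 := fun n => by
    have := hl (ls n)
    rwa [← Function.iterate_succ_apply' l n] at this
  let K : ℤ → ModuleCat.{u} R
    | Int.ofNat n => (ls n).1
    | Int.negSucc n => (rs (n + 1)).1
  exact qgp_of_steps K fun
    | Int.ofNat n => hls n
    | Int.negSucc 0 => hrs 0
    | Int.negSucc (n + 1) => hrs (n + 1)

theorem qgp_cons {M P M' : ModuleCat.{u} R} (hv : VanishExt M) (hP : Projective P)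
    (hs : SES M P M') (hM' : QuasiGorensteinProjective M') : QuasiGorensteinProjective M := by
  refine qgp_coind (fun M => VanishExt M ∧ ∃ P M', Projective P ∧ SES M P M' ∧
    QuasiGorensteinProjective M') ?_ M ⟨hv, P, M', hP, hs, hM'⟩
  rintro A ⟨hA, P, B, hP, hs, hB⟩
  exact ⟨hA, P, B, hP, hs, qgp_vanish hB, qgp_next hB⟩

theorem ses_self_zero (P : ModuleCat.{u} R) (Z : ModuleCat.{u} R) (hZ : Limits.IsZero Z) :
    SES P P Z :=
  ⟨𝟙 P, 0, by simp, (ShortComplex.Splitting.ofIsIsoOfIsZero _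
    (by dsimp; infer_instance) hZ).shortExact⟩

theorem qgp_of_projective (P : ModuleCat.{u} R) (hP : Projective P) :
    QuasiGorensteinProjective P := by
  refine qgp_coind (fun P => Projective P) (fun P hP => ⟨vanish_of_projective P hP, ?_⟩) P hP
  have hZ : Limits.IsZero (ModuleCat.of R PUnit.{u + 1}) := ModuleCat.isZero_of_subsingleton _
  exact ⟨P, _, hP, ses_self_zero P _ hZ, hZ.projective⟩

theorem qgp_extension {A X B : ModuleCat.{u} R} (hs : SES A X B)
    (hA : QuasiGorensteinProjective A) (hB : QuasiGorensteinProjective B) :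
    QuasiGorensteinProjective X := by
  refine qgp_coind (fun X => ∃ A B, SES A X B ∧ QuasiGorensteinProjective A ∧
    QuasiGorensteinProjective B) ?_ X ⟨A, B, hs, hA, hB⟩
  rintro X ⟨A, B, hs, hA, hB⟩
  refine ⟨fun Q hQ n => hs.mid _ (qgp_vanish hA Q hQ n) (qgp_vanish hB Q hQ n), ?_⟩
  obtain ⟨P, A', hP, hsA, hA'⟩ := qgp_next hA
  obtain ⟨P', B', hP', hsB, hB'⟩ := qgp_next hB
  obtain ⟨Y, hY1, hY2⟩ := hs.pushout hsA
  have hY3 := hY1.swap (qgp_vanish hB P (quasiProjective_of_projective P hP) 0)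
  obtain ⟨Z, hZ1, hZ2⟩ := hY3.pushout hsB
  obtain ⟨F, hF1, hF2⟩ := hY2.octahedral hZ2
  exact ⟨Z, F, hZ1.projective hP' hP, hF1, A', B', hF2, hA', hB'⟩

theorem qgpdimLE_succ_ses {n : ℕ} {M : ModuleCat.{u} R} (h : qgpdimLE (n + 1) M) :
    ∃ K G, QuasiGorensteinProjective G ∧ SES K G M ∧ qgpdimLE n K := by
  obtain ⟨K, G, f, g, hG, hf, hg, he, hK⟩ := h
  obtain ⟨w, hS⟩ := SES.of_fun f g hf hg he
  exact ⟨K, G, hG, ⟨f, g, w, hS⟩, hK⟩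

theorem qgpdimLE_succ_of_ses {n : ℕ} {K G M : ModuleCat.{u} R}
    (hG : QuasiGorensteinProjective G) (hs : SES K G M) (hK : qgpdimLE n K) :
    qgpdimLE (n + 1) M := by
  obtain ⟨f, g, w, hS⟩ := hs
  exact ⟨K, G, f, g, hG, hS.moduleCat_injective_f, hS.moduleCat_surjective_g,
    (ShortComplex.ShortExact.moduleCat_exact_iff_function_exact _).1 hS.exact, hK⟩

theorem qgpdimLE_vanish {n : ℕ} {M : ModuleCat.{u} R} (h : qgpdimLE n M)
    (Q : ModuleCat.{u} R) (hQ : QuasiProjective Q) (m : ℕ) (hm : n ≤ m) :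
    Subsingleton (Abelian.Ext.{u} M Q (m + 1)) := by
  induction n generalizing M m with
  | zero => exact qgp_vanish h Q hQ m
  | succ n ih =>
    obtain ⟨K, G, hG, hs, hK⟩ := qgpdimLE_succ_ses h
    obtain ⟨m, rfl⟩ : ∃ k, m = k + 1 := ⟨m - 1, by omega⟩
    exact hs.right (m + 1) (ih hK m (by omega)) (qgp_vanish hG Q hQ (m + 1))

theorem qgpdimLE_drop {n : ℕ} {M : ModuleCat.{u} R} (h : qgpdimLE (n + 1) M)
    (hv : ∀ Q : ModuleCat.{u} R, QuasiProjective Q → Subsingleton (Abelian.Ext.{u} M Q (n + 1))) :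
    qgpdimLE n M := by
  induction n generalizing M with
  | zero =>
    have hV : VanishExt M := by
      intro Q hQ m
      rcases m with _ | m
      · exact hv Q hQ
      · exact qgpdimLE_vanish h Q hQ (m + 1) (by omega)
    obtain ⟨K, G, hG, hs, hK⟩ := qgpdimLE_succ_ses h
    obtain ⟨P, K', hP, hsK, hK'⟩ := qgp_next (M := K) hK
    obtain ⟨X, hX1, hX2⟩ := hs.pushout hsK
    have hX : QuasiGorensteinProjective X := qgp_extension hX2 hG hK'
    have hX3 := hX1.swap (hV P (quasiProjective_of_projective P hP) 0)
    obtain ⟨P0, X', hP0, hsX, hX'⟩ := qgp_next hX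
    obtain ⟨F, hF1, hF2⟩ := hX3.octahedral hsX
    exact qgp_cons hV hP0 hF1 (qgp_extension hF2 (qgp_of_projective P hP) hX')
  | succ n ih =>
    obtain ⟨K, G, hG, hs, hK⟩ := qgpdimLE_succ_ses h
    exact qgpdimLE_succ_of_ses hG hs (ih hK fun Q hQ =>
      hs.left (n + 1) (qgp_vanish hG Q hQ n) (hv Q hQ))

/-- For a module `M` of finite quasi-Gorenstein projective dimension, the dimension
equals the supremum of all `m` such that `Ext^m(M, Q) ≠ 0` for some quasi-projective
module `Q`. -/
theorem qgpdim_eq_sup_ext (M : ModuleCat.{u} R)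
    (hfin : ∃ m : ℕ, qgpdimLE m M) :
    qgpdim M = sSup ((fun m : ℕ => (m : ℕ∞)) ''
      {m : ℕ | ∃ Q : ModuleCat.{u} R, QuasiProjective Q ∧
        ¬ Subsingleton (((Ext ℤ (ModuleCat.{u} R) m).obj (Opposite.op M)).obj Q)}) := by
  classical
  have hn := Nat.find_spec hfin
  have hmin : ∀ m, qgpdimLE m M → Nat.find hfin ≤ m := fun m hm => Nat.find_min' hfin hm
  have hlt : ∀ m, m < Nat.find hfin → ¬ qgpdimLE m M := fun m hm => Nat.find_min hfin hm
  generalize Nat.find hfin = n at hn hmin hlt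
  have hdim : qgpdim M = n := by
    apply le_antisymm
    · exact sInf_le ⟨n, hn, rfl⟩
    · apply le_sInf
      rintro _ ⟨m, hm, rfl⟩
      exact Nat.cast_le.2 (hmin m hm)
  rw [hdim]
  apply le_antisymm
  · rcases n with _ | n
    · simp
    · apply le_sSup
      refine ⟨n + 1, ?_, rfl⟩
      by_contra hcon
      refine hlt n (Nat.lt_succ_self n) (qgpdimLE_drop hn fun Q hQ => ?_)
      by_contra hQ'
      exact hcon ⟨Q, hQ, fun h => hQ' ((ext_bridge M Q n).1 h)⟩
  · apply sSup_le
    rintro _ ⟨m, ⟨Q, hQ, hm⟩, rfl⟩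
    by_contra hlt'
    have hlt'' : n < m := Nat.cast_lt.1 (not_le.1 hlt')
    obtain ⟨m, rfl⟩ : ∃ k, m = k + 1 := ⟨m - 1, by omega⟩
    exact hm ((ext_bridge M Q m).2 (qgpdimLE_vanish hn Q hQ m (by omega)))
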